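/- There exists a real polynomial P in the 48 real coordinates of a tuple (x₁, y₁, …, x₈, y₈) of eight pairs of vectors in ℝ³, with P not identically zero, such that for every tuple with P(x₁, y₁, …, x₈, y₈) ≠ 0: (a) there is no nonzero real 3×3 matrix F with det F = 0 and yᵢᵀ·F·xᵢ = 0 for all i = 1,…,8; and consequently (b) there are no flatland cameras A and B (real 2×3 matrices of rank 2) such that A·xᵢ ≠ 0 and A·xᵢ ∼ B·yᵢ for all i = 1,…,8. -/

import Mathlib

open Matrix

/-- `u ∼ v`: the vectors are equal up to a nonzero real scalar. -/
def Sim {k : ℕ} (u v : Fin k → ℝ) : Prop := ∃ c : ℝ, c ≠ 0 ∧ u = c • v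

/-- The square matrix with first row `c` whose other rows are the coefficient vectors of the
equations `yᵢᵀ F xᵢ = 0` in the nine entries of `F`. -/
def borderedIncidenceMatrix {R : Type*} [CommRing R] (x y : Fin 8 → Fin 3 → R) (c : Fin 9 → R) :
    Matrix (Fin 9) (Fin 9) R :=
  of (Fin.cons c fun i k =>
    y i (finProdFinEquiv (m := 3) (n := 3).symm k).1 *
      x i (finProdFinEquiv (m := 3) (n := 3).symm k).2)

/-- The matrix of signed maximal minors of the system `yᵢᵀ F xᵢ = 0`. -/
def minorMatrix {R : Type*} [CommRing R] (x y : Fin 8 → Fin 3 → R) : Matrix (Fin 3) (Fin 3) R :=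
  of fun a b => (borderedIncidenceMatrix x y (Pi.single (finProdFinEquiv (a, b)) 1)).det

section

variable {R S : Type*} [CommRing R] [CommRing S]

theorem minorMatrix_map (f : R →+* S) (x y : Fin 8 → Fin 3 → R) :
    (minorMatrix x y).map f = minorMatrix (fun i j => f (x i j)) (fun i j => f (y i j)) := by
  ext a b
  simp only [minorMatrix, map_apply, of_apply, RingHom.map_det]
  congr 1
  ext i k
  refine Fin.cases ?_ (fun i => ?_) i
  · by_cases h : k = finProdFinEquiv (a, b) <;>
      simp [borderedIncidenceMatrix, h]
  · simp [borderedIncidenceMatrix]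

theorem borderedIncidenceMatrix_mulVec_zero (x y : Fin 8 → Fin 3 → R) (c v : Fin 9 → R) :
    (borderedIncidenceMatrix x y c *ᵥ v) 0 = c ⬝ᵥ v := by
  simp [borderedIncidenceMatrix, mulVec, dotProduct]

theorem borderedIncidenceMatrix_mulVec_succ (x y : Fin 8 → Fin 3 → R) (c v : Fin 9 → R)
    (i : Fin 8) :
    (borderedIncidenceMatrix x y c *ᵥ v) i.succ =
      y i ⬝ᵥ (of fun a b => v (finProdFinEquiv (a, b))) *ᵥ x i := by
  simp only [borderedIncidenceMatrix, mulVec, dotProduct, of_apply, Fin.cons_succ]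
  rw [← (finProdFinEquiv (m := 3) (n := 3)).sum_comp, Fintype.sum_prod_type]
  simp only [Equiv.symm_apply_apply, Finset.mul_sum]
  exact Finset.sum_congr rfl fun a _ => Finset.sum_congr rfl fun b _ => by ring

/-- The Cramer rule: a solution of the incidence equations is proportional to the minors. -/
theorem minorMatrix_mul_eq (x y : Fin 8 → Fin 3 → R) (F : Matrix (Fin 3) (Fin 3) R)
    (hF : ∀ i, y i ⬝ᵥ F *ᵥ x i = 0) (a b : Fin 3) :
    minorMatrix x y a b • F = F a b • minorMatrix x y := by
  set v : Fin 9 → R := fun k =>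
    F (finProdFinEquiv (m := 3) (n := 3).symm k).1 (finProdFinEquiv (m := 3) (n := 3).symm k).2
    with hv
  have hvF : (of fun a b => v (finProdFinEquiv (a, b))) = F := by
    ext a b
    simp only [hv, of_apply, Equiv.symm_apply_apply]
  set W := borderedIncidenceMatrix x y (Pi.single (finProdFinEquiv (a, b)) 1) with hW
  have hWv : W *ᵥ v = Pi.single 0 (F a b) := by
    ext i
    refine Fin.cases ?_ (fun i => ?_) i
    · rw [hW, borderedIncidenceMatrix_mulVec_zero, single_dotProduct, one_mul, Pi.single_eq_same]
      simp only [hv, Equiv.symm_apply_apply]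
    · rw [hW, borderedIncidenceMatrix_mulVec_succ, hvF, hF i,
        Pi.single_eq_of_ne (Fin.succ_ne_zero i)]
  have hadj : ∀ c d, W.adjugate (finProdFinEquiv (c, d)) 0 = minorMatrix x y c d := by
    intro c d
    rw [adjugate_apply, minorMatrix, of_apply]
    congr 1
    exact congrArg of (Fin.update_cons_zero _ _ _)
  have h : W.adjugate *ᵥ (W *ᵥ v) = W.det • v := by
    rw [mulVec_mulVec, adjugate_mul, smul_mulVec, one_mulVec]
  rw [hWv] at h
  ext c d
  have := congrFun h (finProdFinEquiv (c, d))
  rw [mulVec_single] at this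
  simp only [Pi.smul_apply, col_apply, hadj, hv, Equiv.symm_apply_apply, smul_eq_mul,
    MulOpposite.smul_eq_mul_unop, MulOpposite.unop_op] at this
  rw [Matrix.smul_apply, Matrix.smul_apply, smul_eq_mul, smul_eq_mul, mul_comm (F a b), this,
    minorMatrix, of_apply]

theorem eq_zero_of_det_minorMatrix_ne_zero [IsDomain R] {x y : Fin 8 → Fin 3 → R}
    (h : (minorMatrix x y).det ≠ 0) {F : Matrix (Fin 3) (Fin 3) R} (hdet : F.det = 0)
    (hF : ∀ i, y i ⬝ᵥ F *ᵥ x i = 0) : F = 0 := by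
  ext a b
  have := congrArg det (minorMatrix_mul_eq x y F hF a b)
  rw [det_smul, det_smul, hdet, mul_zero, eq_comm] at this
  exact pow_eq_zero_iff (by simp) |>.1 ((mul_eq_zero.1 this).resolve_right h)

end

/-- Eight pairs of orthogonal vectors whose tensor products span the traceless matrices. -/
theorem exists_det_minorMatrix_ne_zero :
    ∃ x y : Fin 8 → Fin 3 → ℝ, (minorMatrix x y).det ≠ 0 := by
  let x : Fin 8 → Fin 3 → ℝ :=
    ![![0, 1, 0], ![0, 0, 1], ![1, 0, 0], ![0, 0, 1], ![1, 0, 0], ![0, 1, 0],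
      ![1, -1, 0], ![0, 1, -1]]
  let y : Fin 8 → Fin 3 → ℝ :=
    ![![1, 0, 0], ![1, 0, 0], ![0, 1, 0], ![0, 1, 0], ![0, 0, 1], ![0, 0, 1],
      ![1, 1, 0], ![0, 1, 1]]
  refine ⟨x, y, ?_⟩
  have hone : ∀ i, y i ⬝ᵥ (1 : Matrix (Fin 3) (Fin 3) ℝ) *ᵥ x i = 0 := by
    intro i
    rw [one_mulVec]
    fin_cases i <;> simp [x, y, dotProduct, Fin.sum_univ_three]
  have hN := minorMatrix_mul_eq x y 1 hone 0 0
  rw [one_apply_eq, one_smul] at hN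
  rw [← hN, det_smul, det_one, mul_one]
  refine pow_ne_zero _ fun h0 => ?_
  rw [minorMatrix, of_apply] at h0
  obtain ⟨v, hv0, hv⟩ := exists_mulVec_eq_zero_iff.2 h0
  refine hv0 ?_
  have hz := congrFun hv 0
  rw [borderedIncidenceMatrix_mulVec_zero, single_dotProduct, one_mul] at hz
  have hs : ∀ i : Fin 8, y i ⬝ᵥ (of fun a b => v (finProdFinEquiv (a, b))) *ᵥ x i = 0 := by
    intro i
    rw [← borderedIncidenceMatrix_mulVec_succ, hv, Pi.zero_apply]
  have hall : ∀ a b : Fin 3, v (finProdFinEquiv (a, b)) = 0 := by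
    simp only [dotProduct, mulVec, of_apply, Fin.sum_univ_three] at hs
    have h0 := hs 0
    have h1 := hs 1
    have h2 := hs 2
    have h3 := hs 3
    have h4 := hs 4
    have h5 := hs 5
    have h6 := hs 6
    have h7 := hs 7
    generalize (fun a b : Fin 3 => v (finProdFinEquiv (a, b))) = G at *
    simp [x, y, -finProdFinEquiv_apply_val] at h0 h1 h2 h3 h4 h5 h6 h7
    intro a b
    fin_cases a <;> fin_cases b <;> simp only [Fin.zero_eta, Fin.mk_one, Fin.reduceFinMk] <;>
      simp only [Pi.zero_apply] at hz <;> linarith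
  ext k
  simpa using hall (finProdFinEquiv (m := 3) (n := 3).symm k).1
    (finProdFinEquiv (m := 3) (n := 3).symm k).2

theorem Matrix.mulVec_surjective_of_rank_eq {K m n : Type*} [Field K] [Fintype m] [Fintype n]
    {A : Matrix m n K} (h : A.rank = Fintype.card m) : Function.Surjective A.mulVec := by
  have : LinearMap.range A.mulVecLin = ⊤ :=
    Submodule.eq_top_of_finrank_eq (by rw [Module.finrank_fintype_fun_eq_card]; exact h)
  exact LinearMap.range_eq_top.1 this

/-- Two cameras with a common image satisfy a nontrivial singular incidence relation. -/
theorem exists_singular_matrix_of_common_image {ι : Type*} {x y : ι → Fin 3 → ℝ}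
    {A B : Matrix (Fin 2) (Fin 3) ℝ} (hA : A.rank = 2) (hB : B.rank = 2)
    (h : ∀ i, Sim (A *ᵥ x i) (B *ᵥ y i)) :
    ∃ F : Matrix (Fin 3) (Fin 3) ℝ, F ≠ 0 ∧ F.det = 0 ∧ ∀ i, y i ⬝ᵥ F *ᵥ x i = 0 := by
  have key : ∀ p q : Fin 3 → ℝ,
      q ⬝ᵥ (Bᵀ * ((!![0, 1; -1, 0] : Matrix (Fin 2) (Fin 2) ℝ) * A)) *ᵥ p =
      (B *ᵥ q) 0 * (A *ᵥ p) 1 - (B *ᵥ q) 1 * (A *ᵥ p) 0 := by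
    intro p q
    rw [← mulVec_mulVec, dotProduct_mulVec, vecMul_transpose, ← mulVec_mulVec]
    generalize A *ᵥ p = u
    generalize B *ᵥ q = w
    simp [dotProduct, mulVec, Fin.sum_univ_two]
    ring
  refine ⟨Bᵀ * ((!![0, 1; -1, 0] : Matrix (Fin 2) (Fin 2) ℝ) * A), fun h0 => ?_, ?_, fun i => ?_⟩
  · obtain ⟨p, hp⟩ := mulVec_surjective_of_rank_eq (A := A) (by simpa using hA) ![1, 0]
    obtain ⟨q, hq⟩ := mulVec_surjective_of_rank_eq (A := B) (by simpa using hB) ![0, 1]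
    have := key p q
    rw [h0, hp, hq] at this
    simp at this
  · simp [det_fin_three, mul_apply, Fin.sum_univ_two]
    ring
  · obtain ⟨c, -, hc⟩ := h i
    rw [key, hc]
    simp only [Pi.smul_apply, smul_eq_mul]
    ring

/-- Corollary 18: there is a nonzero polynomial `P` in the 48 coordinates of
eight point pairs `(xᵢ, yᵢ)` in ℝ³ such that whenever `P` does not vanish,
(a) no nonzero singular 3×3 matrix satisfies all eight incidence constraints,
and (b) no pair of flatland cameras projects the two point sets to the same
image.  (The variable `(i, tt, j)` stands for the `j`-th coordinate of `xᵢ`,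
and `(i, ff, j)` for the `j`-th coordinate of `yᵢ`.) -/
theorem eight_points_generically_no_common_image :
    ∃ P : MvPolynomial (Fin 8 × Bool × Fin 3) ℝ, P ≠ 0 ∧
      ∀ x y : Fin 8 → Fin 3 → ℝ,
        MvPolynomial.eval
          (fun v => if v.2.1 then x v.1 v.2.2 else y v.1 v.2.2) P ≠ 0 →
        (¬ ∃ F : Matrix (Fin 3) (Fin 3) ℝ, F ≠ 0 ∧ F.det = 0 ∧
            ∀ i, y i ⬝ᵥ F.mulVec (x i) = 0) ∧
        (¬ ∃ A B : Matrix (Fin 2) (Fin 3) ℝ, A.rank = 2 ∧ B.rank = 2 ∧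
            ∀ i, A.mulVec (x i) ≠ 0 ∧ Sim (A.mulVec (x i)) (B.mulVec (y i))) := by
  let P : MvPolynomial (Fin 8 × Bool × Fin 3) ℝ :=
    (minorMatrix (fun i j => MvPolynomial.X (i, true, j))
      (fun i j => MvPolynomial.X (i, false, j))).det
  have heval : ∀ x y : Fin 8 → Fin 3 → ℝ,
      MvPolynomial.eval (fun v => if v.2.1 then x v.1 v.2.2 else y v.1 v.2.2) P =
        (minorMatrix x y).det := by
    intro x y
    rw [RingHom.map_det, RingHom.mapMatrix_apply, minorMatrix_map]
    simp
  refine ⟨P, fun hP => ?_, fun x y hxy => ?_⟩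
  · obtain ⟨x, y, h⟩ := exists_det_minorMatrix_ne_zero
    exact h (by rw [← heval, hP, map_zero])
  · rw [heval] at hxy
    have ha : ¬ ∃ F : Matrix (Fin 3) (Fin 3) ℝ, F ≠ 0 ∧ F.det = 0 ∧
        ∀ i, y i ⬝ᵥ F.mulVec (x i) = 0 := fun ⟨F, hF0, hdet, hF⟩ =>
      hF0 (eq_zero_of_det_minorMatrix_ne_zero hxy hdet hF)
    exact ⟨ha, fun ⟨A, B, hA, hB, h⟩ =>
      ha (exists_singular_matrix_of_common_image hA hB fun i => (h i).2)⟩
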